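/- Let E > 0, ν ≥ 0, and δ ∈ [0, π]. For a ∈ [0, √E] and φ, ψ ∈ ℝ, let P(a, φ, ψ) := P_e(p_{m₀,σ}, p_{m₁,σ}) with means m₀ := a cos(ψ − φ), m₁ := a cos(ψ − φ − δ) and common width σ := √(1+ν). Then the infimum of P(a, φ, ψ) over all a ∈ [0, √E] and φ, ψ ∈ ℝ equals ½(1 − erf(√E sin(δ/2)/√(1+ν))), and it is attained at a = √E, φ = −δ/2, ψ = π/2. -/

import Mathlib

open MeasureTheory

/-- The Gaussian density `p_{m,σ}(x) = (πσ²)^{-1/2} exp(−(x−m)²/σ²)`. -/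
noncomputable def gauss (m σ x : ℝ) : ℝ :=
  (Real.sqrt (Real.pi * σ ^ 2))⁻¹ * Real.exp (-(x - m) ^ 2 / σ ^ 2)

/-- Minimal discrimination error `P_e(p₀,p₁) = ½(1 − ½ ∫ |p₀ − p₁|)`. -/
noncomputable def minErr (p₀ p₁ : ℝ → ℝ) : ℝ :=
  (1/2) * (1 - (1/2) * ∫ x, |p₀ x - p₁ x|)

/-- The error function `erf t = (2/√π) ∫₀ᵗ e^{−s²} ds`. -/
noncomputable def erf (t : ℝ) : ℝ :=
  (2 / Real.sqrt Real.pi) * ∫ s in (0:ℝ)..t, Real.exp (-s ^ 2)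

/-- Error probability of a coherent-probe homodyne strategy with amplitude `a`,
probe phase `φ`, homodyne angle `ψ`, phase shift `δ` and width `σ = √(1+ν)`. -/
noncomputable def Pcoh (ν δ a φ ψ : ℝ) : ℝ :=
  minErr (gauss (a * Real.cos (ψ - φ)) (Real.sqrt (1 + ν)))
    (gauss (a * Real.cos (ψ - φ - δ)) (Real.sqrt (1 + ν)))

theorem setIntegral_Ioi_comp_add_right (f : ℝ → ℝ) (a d : ℝ) :
    ∫ x in Set.Ioi a, f (x + d) = ∫ x in Set.Ioi (a + d), f x := by
  have h := (measurePreserving_add_right volume d).setIntegral_preimage_emb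
    (measurableEmbedding_addRight d) f (Set.Ioi (a + d))
  simpa using h

theorem integrable_exp_neg_sq : Integrable fun x : ℝ => Real.exp (-x ^ 2) := by
  simpa using integrable_exp_neg_mul_sq one_pos

theorem integral_exp_neg_sq_symm (d : ℝ) :
    ∫ x in (-d)..d, Real.exp (-x ^ 2) = 2 * ∫ x in (0:ℝ)..d, Real.exp (-x ^ 2) := by
  have hint : ∀ a b : ℝ, IntervalIntegrable (fun x : ℝ => Real.exp (-x ^ 2)) volume a b :=
    fun a b => integrable_exp_neg_sq.intervalIntegrable
  have h := intervalIntegral.integral_comp_neg (a := 0) (b := d)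
    fun x : ℝ => Real.exp (-x ^ 2)
  simp only [even_two, Even.neg_pow, neg_zero] at h
  rw [← intervalIntegral.integral_add_adjacent_intervals (hint (-d) 0) (hint 0 d), ← h]
  ring

theorem abs_exp_sub_exp_eq {d : ℝ} (hd : 0 ≤ d) (u : ℝ) :
    |Real.exp (-(u + d) ^ 2) - Real.exp (-(u - d) ^ 2)|
      = Real.exp (-(|u| + -d) ^ 2) - Real.exp (-(|u| + d) ^ 2) := by
  rcases le_total 0 u with hu | hu
  · rw [abs_of_nonneg hu, abs_of_nonpos, neg_sub, sub_eq_add_neg u d]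
    rw [sub_nonpos, Real.exp_le_exp]
    nlinarith [mul_nonneg hu hd]
  · rw [abs_of_nonpos hu, abs_of_nonneg]
    · congr 2 <;> ring
    · rw [sub_nonneg, Real.exp_le_exp]
      nlinarith [mul_nonneg (neg_nonneg.2 hu) hd]

theorem integral_abs_exp_sub_exp {d : ℝ} (hd : 0 ≤ d) :
    ∫ u : ℝ, |Real.exp (-(u + d) ^ 2) - Real.exp (-(u - d) ^ 2)|
      = 4 * ∫ x in (0:ℝ)..d, Real.exp (-x ^ 2) := by
  have hi := integrable_exp_neg_sq
  simp_rw [abs_exp_sub_exp_eq hd]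
  rw [integral_comp_abs (f := fun v => Real.exp (-(v + -d) ^ 2) - Real.exp (-(v + d) ^ 2)),
    integral_sub (hi.comp_add_right (-d)).integrableOn (hi.comp_add_right d).integrableOn,
    setIntegral_Ioi_comp_add_right (fun x => Real.exp (-x ^ 2)),
    setIntegral_Ioi_comp_add_right (fun x => Real.exp (-x ^ 2)), zero_add, zero_add,
    intervalIntegral.integral_Ioi_sub_Ioi' hi.integrableOn hi.integrableOn,
    integral_exp_neg_sq_symm]
  ring

theorem minErr_comm (p q : ℝ → ℝ) : minErr p q = minErr q p := by
  simp only [minErr, abs_sub_comm]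

theorem minErr_gauss_of_le {m n σ : ℝ} (hσ : 0 < σ) (h : m ≤ n) :
    minErr (gauss m σ) (gauss n σ) = (1/2) * (1 - erf ((n - m) / (2 * σ))) := by
  set d := (n - m) / (2 * σ) with hd
  have hd0 : 0 ≤ d := div_nonneg (sub_nonneg.2 h) (by positivity)
  set g : ℝ → ℝ := fun u => |Real.exp (-(u + d) ^ 2) - Real.exp (-(u - d) ^ 2)| with hg
  have hpt : ∀ x, |gauss m σ x - gauss n σ x|
      = (Real.sqrt (Real.pi * σ ^ 2))⁻¹ * g ((x - (m + n) / 2) / σ) := by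
    intro x
    rw [gauss, gauss, ← mul_sub, abs_mul, abs_of_nonneg (by positivity), hg]
    congr 4 <;> (rw [hd]; field_simp; ring)
  have hint : ∫ x, |gauss m σ x - gauss n σ x| = 2 * erf d := by
    simp_rw [hpt]
    rw [integral_const_mul, integral_sub_right_eq_self (fun x => g (x / σ)),
      Measure.integral_comp_div g σ, hg, integral_abs_exp_sub_exp hd0, erf, abs_of_pos hσ,
      Real.sqrt_mul Real.pi_pos.le, Real.sqrt_sq hσ.le, smul_eq_mul]
    have := Real.sqrt_pos.2 Real.pi_pos
    field_simp
    ring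
  rw [minErr, hint]
  ring

theorem minErr_gauss {m n σ : ℝ} (hσ : 0 < σ) :
    minErr (gauss m σ) (gauss n σ) = (1/2) * (1 - erf (|m - n| / (2 * σ))) := by
  rcases le_total m n with h | h
  · rw [minErr_gauss_of_le hσ h, abs_of_nonpos (sub_nonpos.2 h), neg_sub]
  · rw [minErr_comm, minErr_gauss_of_le hσ h, abs_of_nonneg (sub_nonneg.2 h)]

theorem erf_monotone : Monotone erf := by
  intro s t hst
  refine mul_le_mul_of_nonneg_left ?_ (by positivity)
  rw [← sub_nonneg, intervalIntegral.integral_interval_sub_left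
    integrable_exp_neg_sq.intervalIntegrable integrable_exp_neg_sq.intervalIntegrable]
  exact intervalIntegral.integral_nonneg hst fun x _ => (Real.exp_pos _).le

theorem Pcoh_eq {ν : ℝ} (hν : 0 ≤ ν) (δ a φ ψ : ℝ) :
    Pcoh ν δ a φ ψ = (1/2) * (1 - erf
      (|a * Real.sin (ψ - φ - δ / 2) * Real.sin (δ / 2)| / Real.sqrt (1 + ν))) := by
  have hcos : a * Real.cos (ψ - φ) - a * Real.cos (ψ - φ - δ)
      = -2 * (a * Real.sin (ψ - φ - δ / 2) * Real.sin (δ / 2)) := by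
    rw [← mul_sub, Real.cos_sub_cos, show (ψ - φ + (ψ - φ - δ)) / 2 = ψ - φ - δ / 2 by ring,
      show (ψ - φ - (ψ - φ - δ)) / 2 = δ / 2 by ring]
    ring
  rw [Pcoh, minErr_gauss (Real.sqrt_pos.2 (by linarith)), hcos, abs_mul, abs_neg, abs_two,
    mul_div_mul_left _ _ two_ne_zero]

/-- Standard Quantum Limit: the infimum of the error over
`a ∈ [0, √E]` and `φ, ψ ∈ ℝ` equals `½(1 − erf(√E sin(δ/2)/√(1+ν)))`, attained
at `a = √E`, `φ = −δ/2`, `ψ = π/2`. -/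
theorem stmt_7 (E ν δ : ℝ) (hE : 0 < E) (hν : 0 ≤ ν) (hδ : δ ∈ Set.Icc 0 Real.pi) :
    IsLeast
      {y : ℝ | ∃ a ∈ Set.Icc 0 (Real.sqrt E), ∃ φ ψ : ℝ, y = Pcoh ν δ a φ ψ}
      ((1/2) * (1 - erf (Real.sqrt E * Real.sin (δ / 2) / Real.sqrt (1 + ν)))) ∧
    Pcoh ν δ (Real.sqrt E) (-δ / 2) (Real.pi / 2)
      = (1/2) * (1 - erf (Real.sqrt E * Real.sin (δ / 2) / Real.sqrt (1 + ν))) := by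
  have hsin : 0 ≤ Real.sin (δ / 2) :=
    Real.sin_nonneg_of_nonneg_of_le_pi (by linarith [hδ.1]) (by linarith [hδ.2, Real.pi_pos])
  have hopt : Pcoh ν δ (Real.sqrt E) (-δ / 2) (Real.pi / 2)
      = (1/2) * (1 - erf (Real.sqrt E * Real.sin (δ / 2) / Real.sqrt (1 + ν))) := by
    rw [Pcoh_eq hν, show Real.pi / 2 - -δ / 2 - δ / 2 = Real.pi / 2 by ring, Real.sin_pi_div_two,
      mul_one, abs_of_nonneg (by positivity)]
  refine ⟨⟨⟨Real.sqrt E, ⟨by positivity, le_rfl⟩, _, _, hopt.symm⟩, ?_⟩, hopt⟩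
  rintro y ⟨a, ⟨ha, haE⟩, φ, ψ, rfl⟩
  rw [Pcoh_eq hν]
  have hle : |a * Real.sin (ψ - φ - δ / 2) * Real.sin (δ / 2)|
      ≤ Real.sqrt E * Real.sin (δ / 2) := by
    rw [abs_mul, abs_mul, abs_of_nonneg ha, abs_of_nonneg hsin]
    refine mul_le_mul_of_nonneg_right ?_ hsin
    exact (mul_le_of_le_one_right ha (Real.abs_sin_le_one _)).trans haE
  have := erf_monotone (div_le_div_of_nonneg_right hle (Real.sqrt_nonneg (1 + ν)))
  linarith
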